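/- Let φ = (√5−1)/2 and define c_0 = 1, c_1 = (3+φ)/5, and c_r = (1/((r−1)φ((r+1)φ+1))) Σ_{k=1}^{r−1} (kφ+1) c_k c_{r−k} for r ≥ 2. Then the sequence M_r = r! c_r / Γ(rφ+1) is a valid moment sequence (the moments of the limiting distribution of L_n/n^φ) and in particular c_r > 0 for all r. -/

import Mathlib

open Real Filter Topology Set MeasureTheory

lemma aux_trunc (x K : ℝ) (hK : 0 < K) : |x - max (-K) (min x K)| ≤ x ^ 2 / K := by
  rw [le_div_iff₀ hK]
  rcases le_total x K with h | h
  · rcases le_total (-K) x with h' | h'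
    · rw [min_eq_left h, max_eq_right h']; simp; positivity
    · rw [min_eq_left h, max_eq_left h', abs_of_nonpos (by linarith)]; nlinarith
  · rw [min_eq_right h, max_eq_right (by linarith), abs_of_nonneg (by linarith)]; nlinarith

lemma moment_limit (ν : ℕ → Measure ℝ) (M : ℕ → ℝ) (hp : ∀ n, IsProbabilityMeasure (ν n))
    (hi : ∀ n r, Integrable (fun x : ℝ => x ^ r) (ν n))
    (hM : ∀ r, Tendsto (fun n => ∫ x, x ^ r ∂(ν n)) atTop (𝓝 (M r))) :
    ∃ μ : Measure ℝ, IsProbabilityMeasure μ ∧ ∀ r : ℕ, ∫ x, x ^ r ∂μ = M r := by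
  -- tightness
  obtain ⟨B, hB⟩ : ∃ B, ∀ n, ∫ x, x ^ 2 ∂(ν n) ≤ B := by
    obtain ⟨B, hB⟩ := (hM 2).bddAbove_range
    exact ⟨B, fun n => hB ⟨n, rfl⟩⟩
  let P : ℕ → ProbabilityMeasure ℝ := fun n => ⟨ν n, hp n⟩
  have htight : IsTightMeasureSet {((μ : ProbabilityMeasure ℝ) : Measure ℝ) | μ ∈ range P} := by
    rw [isTightMeasureSet_iff_exists_isCompact_measure_compl_le]
    intro ε hε
    have hlim : Tendsto (fun R : ℝ => ENNReal.ofReal (B / R ^ 2)) atTop (𝓝 0) := by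
      rw [← ENNReal.ofReal_zero]
      apply ENNReal.tendsto_ofReal
      exact tendsto_const_nhds.div_atTop (tendsto_pow_atTop (by norm_num))
    obtain ⟨R, hR, hR0⟩ := ((hlim.eventually_le_const hε).and (eventually_gt_atTop 0)).exists
    refine ⟨Icc (-R) R, isCompact_Icc, ?_⟩
    rintro _ ⟨_, ⟨n, rfl⟩, rfl⟩
    refine le_trans ?_ hR
    change ν n _ ≤ _
    have := hp n
    have h1 := mul_meas_ge_le_integral_of_nonneg (μ := ν n) (f := fun x : ℝ => x ^ 2)
      (Eventually.of_forall fun x => sq_nonneg x) (hi n 2) (R ^ 2)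
    have h2 : (ν n).real (Icc (-R) R)ᶜ ≤ (ν n).real {x | R ^ 2 ≤ x ^ 2} := by
      refine measureReal_mono ?_ (measure_ne_top _ _)
      intro x hx
      simp only [mem_compl_iff, mem_Icc, not_and_or, not_le] at hx
      simp only [Set.mem_ofPred_eq]
      rcases hx with hx | hx <;> nlinarith
    rw [← ofReal_measureReal]
    apply ENNReal.ofReal_le_ofReal
    rw [le_div_iff₀ (by positivity)]
    have h3 := hB n
    have : 0 < R ^ 2 := by positivity
    nlinarith
  have hcomp := isCompact_closure_of_isTightMeasureSet htight
  obtain ⟨Q, -, hQ⟩ := hcomp.exists_mapClusterPt (f := atTop) (u := P)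
    (by simp only [Filter.le_principal_iff, Filter.mem_map]
        exact Filter.Eventually.of_forall fun n => subset_closure ⟨n, rfl⟩)
  rw [mapClusterPt_iff_ultrafilter] at hQ
  obtain ⟨U, hU, hQ⟩ := hQ
  rw [ProbabilityMeasure.tendsto_iff_forall_integral_tendsto] at hQ
  set μ : Measure ℝ := (Q : Measure ℝ) with hμ
  have hμp : IsProbabilityMeasure μ := Q.2
  -- truncations
  let f : ℕ → ℝ → BoundedContinuousFunction ℝ ℝ := fun r K =>
    BoundedContinuousFunction.ofNormedAddCommGroup
      (fun x : ℝ => max (-|K|) (min (x ^ r) |K|)) (by fun_prop) |K| (by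
        intro x
        rw [Real.norm_eq_abs, abs_le]
        refine ⟨le_max_left _ _, max_le ?_ (min_le_right _ _)⟩
        linarith [abs_nonneg K])
  have hf : ∀ r K, 0 < K → ∀ x, f r K x = max (-K) (min (x ^ r) K) := by
    intro r K hK x
    simp [f, abs_of_pos hK]
  have hfi : ∀ r K (ρ : Measure ℝ) [IsProbabilityMeasure ρ], Integrable (fun x => f r K x) ρ :=
    fun r K ρ _ => (f r K).integrable ρ
  have hbd : ∀ r K (ρ : Measure ℝ) [IsProbabilityMeasure ρ], 0 < K →
      (∀ r : ℕ, Integrable (fun x : ℝ => x ^ r) ρ) →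
      |∫ x, x ^ r ∂ρ - ∫ x, f r K x ∂ρ| ≤ (∫ x, x ^ (2 * r) ∂ρ) / K := by
    intro r K ρ _ hK hρ
    rw [← integral_sub (hρ r) (hfi r K ρ), ← integral_div]
    refine (abs_integral_le_integral_abs).trans ?_
    apply integral_mono_of_nonneg (Eventually.of_forall fun x => abs_nonneg _)
      ((hρ _).div_const _)
    refine Eventually.of_forall fun x => ?_
    simp only [hf r K hK]
    have := aux_trunc (x ^ r) K hK
    rwa [← pow_mul, mul_comm r 2] at this
  have hlimf : ∀ r K, 0 < K → |M r - ∫ x, f r K x ∂μ| ≤ M (2 * r) / K := by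
    intro r K hK
    have t1 : Tendsto (fun n => |∫ x, x ^ r ∂(ν n) - ∫ x, f r K x ∂(ν n)|) U
        (𝓝 |M r - ∫ x, f r K x ∂μ|) := (((hM r).mono_left hU).sub (hQ (f r K))).abs
    have t2 : Tendsto (fun n => (∫ x, x ^ (2 * r) ∂(ν n)) / K) U (𝓝 (M (2 * r) / K)) :=
      ((hM _).mono_left hU).div_const K
    exact le_of_tendsto_of_tendsto' t1 t2 fun n => by
      have := hp n
      exact hbd r K (ν n) hK (hi n)
  -- even moments
  have heven : ∀ r, Integrable (fun x : ℝ => x ^ (2 * r)) μ ∧ ∫ x, x ^ (2 * r) ∂μ ≤ M (2 * r) := by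
    intro r
    have hnn : ∀ x : ℝ, 0 ≤ x ^ (2 * r) := fun x => by rw [pow_mul]; positivity
    have hle : ∀ K : ℝ, 0 < K → ∫ x, f (2 * r) K x ∂μ ≤ M (2 * r) := by
      intro K hK
      refine le_of_tendsto_of_tendsto' (hQ (f (2 * r) K)) ((hM (2 * r)).mono_left hU) fun n => ?_
      have := hp n
      refine integral_mono (hfi _ _ _) (hi n _) fun x => ?_
      simp only [hf _ K hK]
      exact max_le (by linarith [hnn x]) (min_le_left _ _)
    have hl : ∫⁻ x, ENNReal.ofReal (x ^ (2 * r)) ∂μ ≤ ENNReal.ofReal (M (2 * r)) := by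
      have e : ∀ x : ℝ, ENNReal.ofReal (x ^ (2 * r)) =
          liminf (fun K : ℕ => ENNReal.ofReal (f (2 * r) (K + 1) x)) atTop := by
        intro x
        symm
        apply Tendsto.liminf_eq
        apply tendsto_const_nhds.congr'
        obtain ⟨N, hN⟩ := exists_nat_ge (x ^ (2 * r))
        filter_upwards [eventually_ge_atTop N] with K hK
        have : (N : ℝ) ≤ K := by exact_mod_cast hK
        rw [hf _ _ (by positivity), min_eq_left (by linarith), max_eq_right]
        linarith [hnn x]
      simp_rw [e]
      refine (lintegral_liminf_le fun K => ?_).trans ?_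
      · exact ((f (2 * r) (K + 1)).continuous.measurable).ennreal_ofReal
      · refine liminf_le_of_frequently_le' (Frequently.of_forall fun K => ?_)
        rw [← ofReal_integral_eq_lintegral_ofReal (hfi _ _ _)]
        · exact ENNReal.ofReal_le_ofReal (hle _ (by positivity))
        · refine Eventually.of_forall fun x => ?_
          change 0 ≤ f (2 * r) (K + 1) x
          rw [hf _ _ (by positivity)]
          exact le_max_of_le_right (le_min (hnn x) (by positivity))
    have hint : Integrable (fun x : ℝ => x ^ (2 * r)) μ := by
      refine ⟨by fun_prop, ?_⟩
      rw [hasFiniteIntegral_iff_ofReal (Eventually.of_forall hnn)]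
      exact hl.trans_lt ENNReal.ofReal_lt_top
    refine ⟨hint, ?_⟩
    rw [← ofReal_integral_eq_lintegral_ofReal hint (Eventually.of_forall hnn)] at hl
    have hM0 : 0 ≤ M (2 * r) := ge_of_tendsto' (hM _) fun n => integral_nonneg fun x => hnn x
    exact (ENNReal.ofReal_le_ofReal_iff hM0).1 hl
  have hall : ∀ r : ℕ, Integrable (fun x : ℝ => x ^ r) μ := by
    intro r
    refine Integrable.mono' ((integrable_const (1:ℝ)).add (heven r).1) (by fun_prop) ?_
    refine Eventually.of_forall fun x => ?_
    simp only [Pi.add_apply, Real.norm_eq_abs]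
    rw [mul_comm 2 r, pow_mul, ← sq_abs (x ^ r)]
    nlinarith [sq_nonneg (|x ^ r| - 1), abs_nonneg (x ^ r)]
  refine ⟨μ, hμp, fun r => ?_⟩
  have hK : ∀ K : ℝ, 0 < K → |∫ x, x ^ r ∂μ - M r| ≤ 2 * M (2 * r) / K := by
    intro K hK
    have h1 := hbd r K μ hK hall
    have h2 := hlimf r K hK
    have h3 : (∫ x, x ^ (2 * r) ∂μ) / K ≤ M (2 * r) / K := by gcongr; exact (heven r).2
    rw [abs_le] at *
    have : 2 * M (2 * r) / K = M (2 * r) / K + M (2 * r) / K := by ring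
    constructor <;> linarith [h1.1, h1.2, h2.1, h2.2]
  have hlim : Tendsto (fun K : ℝ => 2 * M (2 * r) / K) atTop (𝓝 0) :=
    tendsto_const_nhds.div_atTop tendsto_id
  have := ge_of_tendsto hlim ((eventually_gt_atTop 0).mono hK)
  exact sub_eq_zero.1 (abs_nonpos_iff.1 this)

lemma aux_beta (a b : ℝ) (ha : 0 ≤ a) (hb : 0 ≤ b) :
    ∫ u in Icc (0:ℝ) 1, u ^ a * (1 - u) ^ b =
      Real.Gamma (a + 1) * Real.Gamma (b + 1) / Real.Gamma (a + b + 2) := by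
  have h := ProbabilityTheory.beta_eq_betaIntegralReal (a + 1) (b + 1) (by linarith) (by linarith)
  rw [ProbabilityTheory.beta, show a + 1 + (b + 1) = a + b + 2 by ring] at h
  rw [h, Complex.betaIntegral]
  have : ∀ u ∈ Set.uIcc (0:ℝ) 1, (u : ℂ) ^ (((a + 1 : ℝ) : ℂ) - 1) * (1 - (u : ℂ)) ^ (((b + 1 : ℝ) : ℂ) - 1)
      = ((u ^ a * (1 - u) ^ b : ℝ) : ℂ) := by
    intro u hu
    rw [Set.uIcc_of_le zero_le_one] at hu
    rw [Complex.ofReal_mul, Complex.ofReal_cpow hu.1, Complex.ofReal_cpow (by linarith [hu.2])]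
    push_cast
    simp
  rw [intervalIntegral.integral_congr this, intervalIntegral.integral_ofReal, Complex.ofReal_re,
    intervalIntegral.integral_of_le zero_le_one, integral_Icc_eq_integral_Ioc]

lemma aux_cont (a b : ℝ) (ha : 0 ≤ a) (hb : 0 ≤ b) :
    Continuous (fun u : ℝ => u ^ a * (1 - u) ^ b) :=
  (continuous_id.rpow_const fun _ => Or.inr ha).mul
    ((continuous_const.sub continuous_id).rpow_const fun _ => Or.inr hb)

/-- law of `ξ` -/
noncomputable def auxK : Measure ℝ :=
  (1 / 2 : ENNReal) • Measure.dirac 1 + (1 / 2 : ENNReal) • volume.restrict (Icc (0:ℝ) 1)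

instance auxU_prob : IsProbabilityMeasure (volume.restrict (Icc (0:ℝ) 1)) :=
  ⟨by simp⟩

instance auxK_prob : IsProbabilityMeasure auxK :=
  ⟨by simp [auxK]; exact ENNReal.inv_two_add_inv_two⟩

lemma auxK_int (s : ℝ) (hs : 0 ≤ s) : Integrable (fun x : ℝ => x ^ s) auxK := by
  have hc : Continuous (fun x : ℝ => x ^ s) := continuous_id.rpow_const fun _ => Or.inr hs
  refine Integrable.add_measure ?_ ?_
  · exact (integrable_dirac (by simp)).smul_measure (by simp)
  · exact (hc.continuousOn.integrableOn_compact isCompact_Icc).smul_measure (by simp)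

lemma auxK_moment (s : ℝ) (hs : 0 ≤ s) : ∫ x, x ^ s ∂auxK = (s + 2) / (2 * (s + 1)) := by
  have hc : Continuous (fun x : ℝ => x ^ s) := continuous_id.rpow_const fun _ => Or.inr hs
  rw [auxK, integral_add_measure, integral_smul_measure, integral_smul_measure, integral_dirac,
    integral_Icc_eq_integral_Ioc, ← intervalIntegral.integral_of_le zero_le_one, integral_rpow]
  · simp
    rw [zero_rpow (by linarith)]
    field_simp
    ring
  · left; linarith
  · exact (integrable_dirac (by simp)).smul_measure (by simp)
  · exact (hc.continuousOn.integrableOn_compact isCompact_Icc).smul_measure (by simp)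

lemma auxK_ae : ∀ᵐ x ∂auxK, 0 ≤ x := by
  rw [auxK, ae_add_measure_iff]
  constructor
  · refine Measure.ae_smul_measure ?_ _
    rw [ae_dirac_iff (measurableSet_Ici)]
    exact zero_le_one
  · refine Measure.ae_smul_measure ?_ _
    exact (ae_restrict_mem measurableSet_Icc).mono fun x hx => hx.1

lemma step (φ : ℝ) (hφ : 0 ≤ φ) (μ : Measure ℝ) [IsProbabilityMeasure μ]
    (hi : ∀ r : ℕ, Integrable (fun x : ℝ => x ^ r) μ) :
    ∃ ν : Measure ℝ, IsProbabilityMeasure ν ∧ (∀ r : ℕ, Integrable (fun x : ℝ => x ^ r) ν) ∧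
      ∀ r : ℕ, ∫ x, x ^ r ∂ν = ∑ k ∈ Finset.range (r + 1),
        ((r * φ + 2) / (2 * (r * φ + 1)) *
          (Real.Gamma (k * φ + 1) * Real.Gamma (((r - k : ℕ) : ℝ) * φ + 1) /
            Real.Gamma (r * φ + 2))) *
        ((∫ x, x ^ k ∂μ) * (∫ x, x ^ (r - k) ∂μ)) * (r.choose k : ℝ) := by
  set l : Measure ℝ := volume.restrict (Icc (0:ℝ) 1) with hl
  let g : (ℝ × ℝ) × (ℝ × ℝ) → ℝ := fun p =>
    p.1.1 ^ φ * (p.1.2 ^ φ * p.2.1 + (1 - p.1.2) ^ φ * p.2.2)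
  have hg : Measurable g := by fun_prop
  let ρ := (auxK.prod l).prod (μ.prod μ)
  have hae : ∀ᵐ p ∂ρ, 0 ≤ p.1.1 ∧ 0 ≤ p.1.2 ∧ p.1.2 ≤ 1 := by
    have e1 : ∀ᵐ p ∂(auxK.prod l), 0 ≤ p.1 := Measure.quasiMeasurePreserving_fst.ae auxK_ae
    have e2 : ∀ᵐ p ∂(auxK.prod l), p.2 ∈ Icc (0:ℝ) 1 :=
      Measure.quasiMeasurePreserving_snd.ae (ae_restrict_mem measurableSet_Icc)
    have e3 : ∀ᵐ p ∂(auxK.prod l), 0 ≤ p.1 ∧ 0 ≤ p.2 ∧ p.2 ≤ 1 := by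
      filter_upwards [e1, e2] with p h1 h2 using ⟨h1, h2.1, h2.2⟩
    exact Measure.quasiMeasurePreserving_fst.ae e3
  let t : ℕ → ℕ → (ℝ × ℝ) × (ℝ × ℝ) → ℝ := fun r k p =>
    ((p.1.1 ^ (r * φ)) * (p.1.2 ^ (k * φ) * (1 - p.1.2) ^ (((r - k : ℕ) : ℝ) * φ))) *
      (p.2.1 ^ k * p.2.2 ^ (r - k)) * (r.choose k : ℝ)
  have hti : ∀ r k, Integrable (t r k) ρ := by
    intro r k
    refine Integrable.mul_const ?_ _
    refine Integrable.mul_prod (f := fun q : ℝ × ℝ => q.1 ^ (r * φ) * (q.2 ^ (k * φ) * (1 - q.2) ^ (((r - k : ℕ) : ℝ) * φ)))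
      (g := fun q : ℝ × ℝ => q.1 ^ k * q.2 ^ (r - k)) ?_ ?_
    · exact Integrable.mul_prod (f := fun x : ℝ => x ^ (r * φ)) (auxK_int _ (by positivity))
        ((aux_cont (k * φ) _ (by positivity) (by positivity)).continuousOn.integrableOn_compact isCompact_Icc)
    · exact Integrable.mul_prod (f := fun x : ℝ => x ^ k) (g := fun x : ℝ => x ^ (r - k)) (hi _) (hi _)
  have htm : ∀ r k, k ≤ r → ∫ p, t r k p ∂ρ =
        ((r * φ + 2) / (2 * (r * φ + 1)) *
          (Real.Gamma (k * φ + 1) * Real.Gamma (((r - k : ℕ) : ℝ) * φ + 1) /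
            Real.Gamma (r * φ + 2))) *
        ((∫ x, x ^ k ∂μ) * (∫ x, x ^ (r - k) ∂μ)) * (r.choose k : ℝ) := by
    intro r k hk
    simp only [t]
    rw [integral_mul_const]
    congr 1
    rw [integral_prod_mul (f := fun q : ℝ × ℝ => q.1 ^ (r * φ) * (q.2 ^ (k * φ) * (1 - q.2) ^ (((r - k : ℕ) : ℝ) * φ)))
      (g := fun q : ℝ × ℝ => q.1 ^ k * q.2 ^ (r - k)),
      integral_prod_mul (f := fun x : ℝ => x ^ (r * φ)) (g := fun x : ℝ => x ^ (k * φ) * (1 - x) ^ (((r - k : ℕ) : ℝ) * φ)),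
      integral_prod_mul (f := fun x : ℝ => x ^ k) (g := fun x : ℝ => x ^ (r - k)),
      auxK_moment _ (by positivity), aux_beta _ _ (by positivity) (by positivity)]
    have : (k : ℝ) * φ + ((r - k : ℕ) : ℝ) * φ + 2 = r * φ + 2 := by
      rw [Nat.cast_sub hk]; ring
    rw [this]
  have hgt : ∀ r : ℕ, (fun p => g p ^ r) =ᵐ[ρ] fun p => ∑ k ∈ Finset.range (r + 1), t r k p := by
    intro r
    filter_upwards [hae] with p hp
    obtain ⟨h1, h2, h3⟩ := hp
    simp only [g, t]
    rw [mul_pow, add_pow, Finset.mul_sum]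
    refine Finset.sum_congr rfl fun k _ => ?_
    rw [mul_comm (r:ℝ) φ, mul_comm (k:ℝ) φ, mul_comm ((r - k : ℕ):ℝ) φ, rpow_mul_natCast h1,
      rpow_mul_natCast h2, rpow_mul_natCast (by linarith)]
    ring
  have hgi : ∀ r : ℕ, Integrable (fun p => g p ^ r) ρ := fun r =>
    (integrable_finsetSum _ fun k _ => hti r k).congr (hgt r).symm
  refine ⟨ρ.map g, Measure.isProbabilityMeasure_map hg.aemeasurable, fun r => ?_, fun r => ?_⟩
  · rw [integrable_map_measure (by fun_prop) hg.aemeasurable]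
    exact hgi r
  · rw [integral_map hg.aemeasurable (by fun_prop), integral_congr_ae (hgt r),
      integral_finsetSum _ fun k _ => hti r k]
    refine Finset.sum_congr rfl fun k hk => htm r k ?_
    have := Finset.mem_range.1 hk
    omega

lemma aux_rec (q b : ℝ) (hq0 : 0 ≤ q) (hq : q < 1) (x y : ℕ → ℝ)
    (hx : ∀ n, x (n + 1) = q * x n + y n) (hy : Tendsto y atTop (𝓝 b)) :
    Tendsto x atTop (𝓝 (b / (1 - q))) := by
  have hq1 : 0 < 1 - q := by linarith
  set L := b / (1 - q) with hL
  have hLb : L = q * L + b := by rw [hL]; field_simp; ring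
  rw [Metric.tendsto_atTop] at hy ⊢
  intro ε hε
  obtain ⟨N, hN⟩ := hy (ε * (1 - q) / 2) (by positivity)
  have key : ∀ k, |x (N + k) - L| ≤ q ^ k * |x N - L| + ε / 2 := by
    intro k
    induction k with
    | zero => simp; positivity
    | succ k ih =>
      have h1 := hN (N + k) (by omega)
      rw [Real.dist_eq] at h1
      have h2 : x (N + (k + 1)) - L = q * (x (N + k) - L) + (y (N + k) - b) := by
        rw [← add_assoc, hx]; linarith
      rw [h2]
      refine (abs_add_le _ _).trans ?_
      rw [abs_mul, abs_of_nonneg hq0, pow_succ]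
      nlinarith
  have hl : Tendsto (fun k : ℕ => q ^ k * |x N - L|) atTop (𝓝 0) := by
    simpa using (tendsto_pow_atTop_nhds_zero_of_lt_one hq0 hq).mul_const |x N - L|
  obtain ⟨K, hK⟩ := eventually_atTop.1 (hl.eventually_lt_const (half_pos hε))
  refine ⟨N + K, fun n hn => ?_⟩
  obtain ⟨k, rfl⟩ : ∃ k, n = N + k := ⟨n - N, by omega⟩
  rw [Real.dist_eq]
  have := key k
  have := hK k (by omega)
  linarith

lemma aux_sum_split (a : ℕ → ℝ) (r : ℕ) (hr : 1 ≤ r) :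
    ∑ k ∈ Finset.range (r + 1), a k * a (r - k) =
      2 * (a 0 * a r) + ∑ k ∈ Finset.Ico 1 r, a k * a (r - k) := by
  rw [Finset.sum_range_succ, Finset.range_eq_Ico, Finset.sum_eq_sum_Ico_succ_bot (by omega)]
  simp
  ring

lemma aux_sum_symm (φ : ℝ) (a : ℕ → ℝ) (r : ℕ) :
    ∑ k ∈ Finset.Ico 1 r, ((k : ℝ) * φ + 1) * a k * a (r - k) =
      (r * φ + 2) / 2 * ∑ k ∈ Finset.Ico 1 r, a k * a (r - k) := by
  have h : ∑ k ∈ Finset.Ico 1 r, ((k : ℝ) * φ + 1) * a k * a (r - k) =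
      ∑ k ∈ Finset.Ico 1 r, (((r - k : ℕ) : ℝ) * φ + 1) * a k * a (r - k) := by
    refine Finset.sum_nbij' (fun k => r - k) (fun k => r - k) ?_ ?_ ?_ ?_ ?_
    · intro k hk; simp only [Finset.mem_Ico] at *; omega
    · intro k hk; simp only [Finset.mem_Ico] at *; omega
    · intro k hk; simp only [Finset.mem_Ico] at *; omega
    · intro k hk; simp only [Finset.mem_Ico] at *; omega
    · intro k hk
      simp only [Finset.mem_Ico] at hk
      have : r - (r - k) = k := by omega
      rw [this]; ring
  have h2 : ∑ k ∈ Finset.Ico 1 r, ((k : ℝ) * φ + 1) * a k * a (r - k) +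
      ∑ k ∈ Finset.Ico 1 r, (((r - k : ℕ) : ℝ) * φ + 1) * a k * a (r - k) =
      (r * φ + 2) * ∑ k ∈ Finset.Ico 1 r, a k * a (r - k) := by
    rw [← Finset.sum_add_distrib, Finset.mul_sum]
    refine Finset.sum_congr rfl fun k hk => ?_
    simp only [Finset.mem_Ico] at hk
    rw [Nat.cast_sub (by omega)]; ring
  linarith

/-- probability measures with all moments -/
def AuxP : Type := {μ : Measure ℝ // IsProbabilityMeasure μ ∧
  ∀ r : ℕ, Integrable (fun x : ℝ => x ^ r) μ}

lemma aux_main (φ : ℝ) (hφ : 0 < φ) (hφ2 : φ ^ 2 + φ = 1) (c : ℕ → ℝ)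
    (h0 : c 0 = 1)
    (hrec : ∀ r : ℕ, 2 ≤ r → c r =
      (1 / (((r : ℝ) - 1) * φ * (((r : ℝ) + 1) * φ + 1))) *
        ∑ k ∈ Finset.Ico 1 r, ((k : ℝ) * φ + 1) * c k * c (r - k)) :
    ∃ μ : Measure ℝ, IsProbabilityMeasure μ ∧
      ∀ r : ℕ, (∫ x, x ^ r ∂μ) = (r.factorial : ℝ) * c r / Real.Gamma ((r : ℝ) * φ + 1) := by
  have hG : ∀ r : ℕ, 0 < Real.Gamma ((r : ℝ) * φ + 1) := fun r =>
    Real.Gamma_pos_of_pos (by positivity)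
  have hstep : ∀ p : AuxP, ∃ q : AuxP, ∀ r : ℕ, ∫ x, x ^ r ∂q.1 = ∑ k ∈ Finset.range (r + 1),
        ((r * φ + 2) / (2 * (r * φ + 1)) *
          (Real.Gamma (k * φ + 1) * Real.Gamma (((r - k : ℕ) : ℝ) * φ + 1) /
            Real.Gamma (r * φ + 2))) *
        ((∫ x, x ^ k ∂p.1) * (∫ x, x ^ (r - k) ∂p.1)) * (r.choose k : ℝ) := by
    intro p
    have := p.2.1
    obtain ⟨ν, h1, h2, h3⟩ := step φ hφ.le p.1 p.2.2
    exact ⟨⟨ν, h1, h2⟩, h3⟩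
  choose T hT using hstep
  let p0 : AuxP := ⟨Measure.dirac (c 1 / Real.Gamma (φ + 1)), inferInstance,
    fun r => integrable_dirac (by simp)⟩
  let ν : ℕ → AuxP := fun n => Nat.rec p0 (fun _ p => T p) n
  have hν : ∀ n, ν (n + 1) = T (ν n) := fun n => rfl
  let d : ℕ → ℕ → ℝ := fun n r => (∫ x, x ^ r ∂(ν n).1) * Real.Gamma (r * φ + 1) / r.factorial
  have hd : ∀ n r, d (n + 1) r = (r * φ + 2) / (2 * (r * φ + 1) ^ 2) *
      ∑ k ∈ Finset.range (r + 1), d n k * d n (r - k) := by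
    intro n r
    simp only [d]
    rw [hν, hT, Finset.sum_mul, Finset.sum_div, Finset.mul_sum]
    refine Finset.sum_congr rfl fun k hk => ?_
    have hk' : k ≤ r := by have := Finset.mem_range.1 hk; omega
    have e : (r : ℝ) * φ + 2 = (r * φ + 1) + 1 := by ring
    have hs : (0:ℝ) < r * φ + 1 := by positivity
    have e2 : Real.Gamma (r * φ + 2) = (r * φ + 1) * Real.Gamma (r * φ + 1) := by
      rw [e, Real.Gamma_add_one hs.ne']
    rw [e2, Nat.cast_choose ℝ hk']
    have := (hG r).ne'
    have f1 : ((k.factorial : ℕ) : ℝ) ≠ 0 := by positivity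
    have f2 : (((r - k).factorial : ℕ) : ℝ) ≠ 0 := by positivity
    have f3 : ((r.factorial : ℕ) : ℝ) ≠ 0 := by positivity
    field_simp
  have hd0 : ∀ n, d n 0 = 1 := by
    intro n
    have := (ν n).2.1
    simp [d]
  have hd1 : ∀ n, d n 1 = c 1 := by
    intro n
    induction n with
    | zero =>
      have := hG 1
      simp at this
      change (∫ x, x ^ 1 ∂(Measure.dirac (c 1 / Real.Gamma (φ + 1)))) *
        Real.Gamma (((1 : ℕ) : ℝ) * φ + 1) / ((1 : ℕ).factorial : ℝ) = c 1
      rw [integral_dirac]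
      simp
      field_simp
    | succ n ih =>
      rw [hd, aux_sum_split _ _ le_rfl, hd0, ih]
      have : φ + 1 ≠ 0 := by positivity
      simp
      field_simp
      linear_combination (-c 1) * hφ2
  have hlim : ∀ r, Tendsto (fun n => d n r) atTop (𝓝 (c r)) := by
    intro r
    induction r using Nat.strong_induction_on with
    | _ r ih =>
      rcases Nat.lt_or_ge r 2 with hr | hr
      · interval_cases r
        · simp [hd0, h0]
        · simp [hd1]
      · set s : ℝ := r * φ with hs
        have hr' : (2:ℝ) ≤ r := by exact_mod_cast hr
        have hs0 : 0 < s := by positivity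
        have hs1 : 1 < s ^ 2 + s := by
          have : 2 * φ ≤ s := by rw [hs]; nlinarith
          nlinarith
        have hlim2 := aux_rec ((s + 2) / (s + 1) ^ 2)
          ((s + 2) / (2 * (s + 1) ^ 2) * ∑ k ∈ Finset.Ico 1 r, c k * c (r - k))
          (by positivity) (by rw [div_lt_one (by positivity)]; nlinarith)
          (fun n => d n r)
          (fun n => (s + 2) / (2 * (s + 1) ^ 2) * ∑ k ∈ Finset.Ico 1 r, d n k * d n (r - k))
          (fun n => by
            rw [hd, aux_sum_split _ _ (by omega), hd0, ← hs]
            field_simp)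
          (by
            refine Tendsto.const_mul _ (tendsto_finsetSum _ fun k hk => ?_)
            simp only [Finset.mem_Ico] at hk
            exact (ih k (by omega)).mul (ih (r - k) (by omega)))
        convert hlim2 using 2
        rw [hrec r hr, aux_sum_symm, ← hs]
        have e1 : ((r : ℝ) - 1) * φ * (((r : ℝ) + 1) * φ + 1) = s ^ 2 + s - 1 := by
          rw [hs]; linear_combination (-1 : ℝ) * hφ2
        rw [e1]
        have e2 : 1 - (s + 2) / (s + 1) ^ 2 = (s ^ 2 + s - 1) / (s + 1) ^ 2 := by
          field_simp; ring
        rw [e2]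
        have : s ^ 2 + s - 1 ≠ 0 := by linarith
        have : s + 1 ≠ 0 := by positivity
        field_simp
  refine moment_limit (fun n => (ν n).1) _ (fun n => (ν n).2.1) (fun n => (ν n).2.2) fun r => ?_
  have := ((hlim r).const_mul (r.factorial : ℝ)).div_const (Real.Gamma ((r : ℝ) * φ + 1))
  refine this.congr fun n => ?_
  have := (hG r).ne'
  simp only [d]
  field_simp



/-- The recursively defined sequence `c_r` (with `φ = (√5-1)/2`) is well defined and strictly
positive, and `M_r = r! c_r / Γ(rφ+1)` is the moment sequence of a probability distribution
(the limit law of `L_n/n^φ`). -/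
theorem stmt12 (c : ℕ → ℝ)
    (h0 : c 0 = 1) (h1 : c 1 = (3 + (Real.sqrt 5 - 1) / 2) / 5)
    (hrec : ∀ r : ℕ, 2 ≤ r → c r =
      (1 / (((r : ℝ) - 1) * ((Real.sqrt 5 - 1) / 2) *
          (((r : ℝ) + 1) * ((Real.sqrt 5 - 1) / 2) + 1))) *
        ∑ k ∈ Finset.Ico 1 r,
          ((k : ℝ) * ((Real.sqrt 5 - 1) / 2) + 1) * c k * c (r - k)) :
    (∀ r : ℕ, 0 < c r) ∧
    ∃ μ : Measure ℝ, IsProbabilityMeasure μ ∧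
      ∀ r : ℕ, (∫ x, x ^ r ∂μ) =
        (r.factorial : ℝ) * c r / Real.Gamma ((r : ℝ) * ((Real.sqrt 5 - 1) / 2) + 1) := by
  have h5 : Real.sqrt 5 ^ 2 = 5 := Real.sq_sqrt (by norm_num)
  have h5' : 1 < Real.sqrt 5 := by
    rw [Real.lt_sqrt (by norm_num)]; norm_num
  have hφ : 0 < (Real.sqrt 5 - 1) / 2 := by linarith
  refine ⟨?_, aux_main _ hφ (by linear_combination h5 / 4) c h0 hrec⟩
  intro r
  induction r using Nat.strong_induction_on with
  | _ r ih =>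
    rcases Nat.lt_or_ge r 2 with hr | hr
    · interval_cases r
      · rw [h0]; norm_num
      · rw [h1]; positivity
    · rw [hrec r hr]
      have hr' : (2:ℝ) ≤ r := by exact_mod_cast hr
      have : (0:ℝ) < r - 1 := by linarith
      refine mul_pos (by positivity) (Finset.sum_pos (fun k hk => ?_) ⟨1, by simp; omega⟩)
      simp only [Finset.mem_Ico] at hk
      have := ih k (by omega)
      have := ih (r - k) (by omega)
      positivity
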